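/- arXiv:2402.04242 — 4 statements merged into one kernel-verified Lean document; each statement's English description precedes it below -/
import Mathlib

section
/- Let w be an exact weight on a class 𝒮 of objects of a pretriangulated category 𝒯, where 𝒮 is closed under the suspension Σ and its inverse. Then for all objects X and Y of 𝒯 and every integer i, d_w(X,Y) = d_w(Σ^i X, Σ^i Y), where d_w is the path metric associated to w. -/
open CategoryTheory CategoryTheory.Limits CategoryTheory.Pretriangulated ZeroObject
open scoped ENNReal

universe v u

namespace ExactWeightsTriangulated

variable {C : Type u} [Category.{v} C] [HasZeroObject C] [Preadditive C] [HasShift C ℤ]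
  [∀ n : ℤ, (CategoryTheory.shiftFunctor C n).Additive] [Pretriangulated C]

/-- A zigzag of morphisms from `X` to `Y`, each equipped with a chosen cone lying in the
class `S` (i.e. each morphism belongs to `ℳ(S)`). -/
inductive ConeZigzag (S : Set C) : C → C → Type (max u v)
  | nil (X : C) : ConeZigzag S X X
  | fwd {X Y W : C} (f : X ⟶ Y) (Z : C) (g : Y ⟶ Z) (h : Z ⟶ X⟦(1 : ℤ)⟧)
      (hZ : Z ∈ S) (hT : Triangle.mk f g h ∈ distTriang C)
      (rest : ConeZigzag S Y W) : ConeZigzag S X W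
  | bwd {X Y W : C} (f : Y ⟶ X) (Z : C) (g : X ⟶ Z) (h : Z ⟶ Y⟦(1 : ℤ)⟧)
      (hZ : Z ∈ S) (hT : Triangle.mk f g h ∈ distTriang C)
      (rest : ConeZigzag S Y W) : ConeZigzag S X W

/-- The cost of a zigzag: the sum of the weights of the cones of its morphisms. -/
noncomputable def cost {S : Set C} (w : C → ℝ≥0∞) : ∀ {X Y : C}, ConeZigzag S X Y → ℝ≥0∞
  | _, _, .nil _ => 0
  | _, _, .fwd _ Z _ _ _ _ rest => w Z + cost w rest
  | _, _, .bwd _ Z _ _ _ _ rest => w Z + cost w rest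

/-- The path metric `d_w` associated to the weight `w` on the class `S`:
the infimum of the costs of `ℳ(S)`-zigzags from `X` to `Y`. -/
noncomputable def pathDist (S : Set C) (w : C → ℝ≥0∞) (X Y : C) : ℝ≥0∞ :=
  ⨅ (γ : ConeZigzag S X Y), cost w γ

/-- A weight `w` on a class `S` of objects of a pretriangulated category is *exact* if for
every distinguished triangle `X ⟶ Y ⟶ Z ⟶ X⟦1⟧` with all three terms in `S`, the weight of
each term is at most the sum of the weights of the other two. -/
def IsExactWeight (S : Set C) (w : C → ℝ≥0∞) : Prop :=
  ∀ T ∈ distTriang C, T.obj₁ ∈ S → T.obj₂ ∈ S → T.obj₃ ∈ S →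
    w T.obj₁ ≤ w T.obj₂ + w T.obj₃ ∧ w T.obj₂ ≤ w T.obj₁ + w T.obj₃ ∧
      w T.obj₃ ≤ w T.obj₁ + w T.obj₂

/-- An exact weight is invariant under the suspension. -/
lemma IsExactWeight.shift_one {S : Set C} {w : C → ℝ≥0∞} (hw : IsExactWeight S w)
    (hS0 : (0 : C) ∈ S) (hw0 : w 0 = 0) {X : C} (hX : X ∈ S) (hX1 : X⟦(1 : ℤ)⟧ ∈ S) :
    w (X⟦(1 : ℤ)⟧) = w X := by
  obtain ⟨h₁, -, h₃⟩ := hw _ (rot_of_distTriang _ (contractible_distinguished X)) hX hS0 hX1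
  simp only [Triangle.rotate_obj₁, Triangle.rotate_obj₂, Triangle.rotate_obj₃,
    contractibleTriangle_obj₁, contractibleTriangle_obj₂, contractibleTriangle_obj₃,
    hw0, zero_add, add_zero] at h₁ h₃
  exact le_antisymm h₃ h₁

/-- An exact weight on a shift-stable class is invariant under all shifts. -/
lemma IsExactWeight.shift {S : Set C} {w : C → ℝ≥0∞} (hw : IsExactWeight S w)
    (hS0 : (0 : C) ∈ S) (hw0 : w 0 = 0) (hwiso : ∀ {X Y : C}, (X ≅ Y) → w X = w Y)
    (hSshift : ∀ X ∈ S, ∀ i : ℤ, (X⟦i⟧ : C) ∈ S) {X : C} (hX : X ∈ S) (n : ℤ) :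
    w (X⟦n⟧) = w X := by
  have step (k : ℤ) : w (X⟦k + 1⟧) = w (X⟦k⟧) :=
    (hwiso ((shiftFunctorAdd C k 1).app X)).trans
      (hw.shift_one hS0 hw0 (hSshift X hX k) (hSshift _ (hSshift X hX k) 1))
  induction n with
  | zero => exact hwiso ((shiftFunctorZero C ℤ).app X)
  | succ k ih => exact (step k).trans ih
  | pred k ih =>
    have h := step (-(k : ℤ) - 1)
    rw [sub_add_cancel] at h
    exact h.symm.trans ih

/-- Any shift of a zigzag is a zigzag, of the same cost if the weight is shift-invariant. -/
lemma ConeZigzag.exists_shift {S : Set C} {w : C → ℝ≥0∞} (n : ℤ)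
    (hS : ∀ Z ∈ S, Z⟦n⟧ ∈ S) (hw : ∀ Z ∈ S, w (Z⟦n⟧) = w Z) {X Y : C}
    (γ : ConeZigzag S X Y) :
    ∃ δ : ConeZigzag S (X⟦n⟧) (Y⟦n⟧), cost w δ = cost w γ := by
  induction γ with
  | nil X => exact ⟨.nil _, rfl⟩
  | fwd f Z g h hZ hT rest ih =>
    obtain ⟨δ, hδ⟩ := ih
    exact ⟨.fwd _ (Z⟦n⟧) _ _ (hS Z hZ) (Triangle.shift_distinguished _ hT n) δ,
      congrArg₂ (· + ·) (hw Z hZ) hδ⟩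
  | bwd f Z g h hZ hT rest ih =>
    obtain ⟨δ, hδ⟩ := ih
    exact ⟨.bwd _ (Z⟦n⟧) _ _ (hS Z hZ) (Triangle.shift_distinguished _ hT n) δ,
      congrArg₂ (· + ·) (hw Z hZ) hδ⟩

lemma isIso_distinguished {X Y : C} (e : X ≅ Y) :
    Triangle.mk e.hom (0 : Y ⟶ 0) (0 : 0 ⟶ X⟦(1 : ℤ)⟧) ∈ distTriang C :=
  (Triangle.distinguished_iff_of_isZero₃ _ (isZero_zero C)).2 (inferInstanceAs (IsIso e.hom))

/-- The endpoint of a zigzag can be replaced by an isomorphic object at no cost. -/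
lemma ConeZigzag.exists_of_iso_right {S : Set C} {w : C → ℝ≥0∞} (hS0 : (0 : C) ∈ S)
    (hw0 : w 0 = 0) {X Y Y' : C} (γ : ConeZigzag S X Y) (e : Y ≅ Y') :
    ∃ δ : ConeZigzag S X Y', cost w δ = cost w γ := by
  induction γ with
  | nil X => exact ⟨.fwd e.hom 0 0 0 hS0 (isIso_distinguished e) (.nil _), by simp [cost, hw0]⟩
  | fwd f Z g h hZ hT rest ih =>
    obtain ⟨δ, hδ⟩ := ih e
    exact ⟨.fwd f Z g h hZ hT δ, congrArg (w Z + ·) hδ⟩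
  | bwd f Z g h hZ hT rest ih =>
    obtain ⟨δ, hδ⟩ := ih e
    exact ⟨.bwd f Z g h hZ hT δ, congrArg (w Z + ·) hδ⟩

/-- Both ends of a zigzag can be replaced by isomorphic objects at no cost. -/
lemma ConeZigzag.exists_of_iso {S : Set C} {w : C → ℝ≥0∞} (hS0 : (0 : C) ∈ S)
    (hw0 : w 0 = 0) {X X' Y Y' : C} (γ : ConeZigzag S X Y) (e : X ≅ X') (e' : Y ≅ Y') :
    ∃ δ : ConeZigzag S X' Y', cost w δ = cost w γ := by
  obtain ⟨δ, hδ⟩ := γ.exists_of_iso_right hS0 hw0 e'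
  exact ⟨.fwd e.symm.hom 0 0 0 hS0 (isIso_distinguished e.symm) δ, by simp [cost, hw0, hδ]⟩

/-- Lemma 1.2(ii): if `w` is an exact weight on a class `S` closed under the suspension and
its inverse, then the path metric is invariant under all suspensions. -/
theorem pathDist_shift (S : Set C) (w : C → ℝ≥0∞)
    (hS0 : (0 : C) ∈ S) (hSiso : ∀ {X Y : C}, (X ≅ Y) → X ∈ S → Y ∈ S)
    (hw0 : w 0 = 0) (hwiso : ∀ {X Y : C}, (X ≅ Y) → w X = w Y)
    (hSshift : ∀ X ∈ S, ∀ i : ℤ, (X⟦i⟧ : C) ∈ S)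
    (hw : IsExactWeight S w) :
    ∀ (X Y : C) (i : ℤ), pathDist S w X Y = pathDist S w (X⟦i⟧) (Y⟦i⟧) := by
  intro X Y i
  have hshift (n : ℤ) {X Y : C} (γ : ConeZigzag S X Y) :=
    γ.exists_shift n (fun Z hZ => hSshift Z hZ n)
      (fun Z hZ => hw.shift hS0 hw0 hwiso hSshift hZ n)
  refine le_antisymm (le_iInf fun γ => ?_) (le_iInf fun γ => ?_)
  · obtain ⟨δ, hδ⟩ := hshift (-i) γ
    obtain ⟨ε, hε⟩ := δ.exists_of_iso hS0 hw0 (shiftShiftNeg X i) (shiftShiftNeg Y i)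
    exact (iInf_le _ ε).trans_eq (hε.trans hδ)
  · obtain ⟨δ, hδ⟩ := hshift i γ
    exact (iInf_le _ δ).trans_eq hδ

end ExactWeightsTriangulated
end

section
/- Let 𝒯 be a pretriangulated category with suspension Σ, 𝒜 an abelian category, F : 𝒯 → 𝒜 a homological functor (or F : 𝒯^op → 𝒜 a cohomological functor), 𝒪 a class of objects of 𝒜 closed under kernels and cokernels, and w : 𝒪 → [0,∞) an additive weight. Then the induced weight w̲_F, defined on ℒ_{𝒯,F,𝒪,w} by w̲_F(X) = |Σ_{i∈ℤ} (−1)^i w(F^i(X))|, is an exact weight: for every distinguished triangle X → Y → Z → ΣX with all three terms in ℒ_{𝒯,F,𝒪,w}, w̲_F(X) ≤ w̲_F(Y)+w̲_F(Z), w̲_F(Y) ≤ w̲_F(X)+w̲_F(Z), and w̲_F(Z) ≤ w̲_F(X)+w̲_F(Y). -/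
open CategoryTheory CategoryTheory.Limits CategoryTheory.Pretriangulated ZeroObject
open scoped ENNReal NNReal

universe v u v₂ u₂

namespace ExactWeightsTriangulated

variable {C : Type u} [Category.{v} C] [HasZeroObject C] [Preadditive C] [HasShift C ℤ]
  [∀ n : ℤ, (CategoryTheory.shiftFunctor C n).Additive] [Pretriangulated C]

variable {A : Type u₂} [Category.{v₂} A] [Abelian A]

/-- A class of objects `O` of an abelian category is closed under kernels and cokernels if
for every morphism between objects of `O`, both its kernel and its cokernel lie in `O`. -/
def ClosedUnderKerCoker (O : Set A) : Prop :=
  ∀ ⦃X Y : A⦄ (f : X ⟶ Y), X ∈ O → Y ∈ O → kernel f ∈ O ∧ cokernel f ∈ O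

/-- A weight `w` on a class `O` of objects of an abelian category is *additive* if for every
short exact sequence `0 → A → B → C → 0` with all terms in `O`, `w B = w A + w C`. -/
def IsAdditiveWeight (O : Set A) (w : A → ℝ≥0) : Prop :=
  ∀ (Sc : ShortComplex A), Sc.ShortExact → Sc.X₁ ∈ O → Sc.X₂ ∈ O → Sc.X₃ ∈ O →
    w Sc.X₂ = w Sc.X₁ + w Sc.X₃

/-- The class `ℒ_{𝒯, F, 𝒪, w}` of objects `X` of `𝒯` such that `F^i(X) = F(X⟦i⟧)` lies in
`𝒪` for every `i : ℤ` (with finite weight, which is automatic here), and `F^i(X) ≠ 0` for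
only finitely many `i`. -/
def LClass (F : C ⥤ A) (O : Set A) : Set C :=
  {X | (∀ i : ℤ, F.obj (X⟦i⟧) ∈ O) ∧ {i : ℤ | ¬ IsZero (F.obj (X⟦i⟧))}.Finite}

/-- The weight `w̲_F` induced on `ℒ_{𝒯, F, 𝒪, w}` by a weight `w` and a (co)homological
functor `F`: `w̲_F(X) = |∑ i, (-1)^i w (F^i X)|`. -/
noncomputable def inducedWeight (F : C ⥤ A) (w : A → ℝ≥0) (X : C) : ℝ :=
  |∑ᶠ i : ℤ, (-1 : ℝ) ^ i * (w (F.obj (X⟦i⟧)) : ℝ)|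

/-- An additive weight vanishes on the zero objects of its class. -/
lemma IsAdditiveWeight.eq_zero_of_isZero {O : Set A} {w : A → ℝ≥0} (hadd : IsAdditiveWeight O w)
    {X : A} (hX : X ∈ O) (h : IsZero X) : w X = 0 := by
  have hS : (ShortComplex.mk (0 : X ⟶ X) (0 : X ⟶ X) zero_comp).ShortExact :=
    { exact := ShortComplex.exact_of_isZero_X₂ _ h
      mono_f := ⟨fun _ _ _ => h.eq_of_tgt _ _⟩
      epi_g := ⟨fun _ _ _ => h.eq_of_src _ _⟩ }
  simpa using hadd _ hS hX hX hX

/-- If `X₁ ⟶ X₂ ⟶ X₃` is exact at `X₂`, then the weight of `X₁` is the sum of the weights of the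
kernels of the two morphisms. -/
lemma IsAdditiveWeight.eq_add_of_exact {O : Set A} {w : A → ℝ≥0} (hadd : IsAdditiveWeight O w)
    (hker : ClosedUnderKerCoker O) {S : ShortComplex A} (hS : S.Exact)
    (h₁ : S.X₁ ∈ O) (h₂ : S.X₂ ∈ O) (h₃ : S.X₃ ∈ O) :
    w S.X₁ = w (kernel S.f) + w (kernel S.g) := by
  have hzero : kernel.ι S.f ≫ kernel.lift S.g S.f S.zero = 0 := by
    simp [← cancel_mono (kernel.ι S.g)]
  have hE : (ShortComplex.mk _ _ hzero).ShortExact :=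
    { exact := by
        refine ShortComplex.exact_of_f_is_kernel _
          (KernelFork.IsLimit.ofι' _ _ fun k hk => ⟨kernel.lift S.f k ?_, kernel.lift_ι _ _ _⟩)
        simpa using hk =≫ kernel.ι S.g
      mono_f := inferInstanceAs (Mono (kernel.ι S.f))
      epi_g := hS.epi_kernelLift }
  exact hadd _ hE (hker S.f h₁ h₂).1 h₁ (hker S.g h₂ h₃).1

/-- The alternating sums of the terms of a finitely supported long exact sequence, whose weights are
expressed through the weights `a`, `b`, `c` of its kernels, are additive. -/
lemma finsum_negOnePow_mul_eq_add {x y z a b c : ℤ → ℝ≥0}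
    (hx : ∀ i, x i = a i + b i) (hy : ∀ i, y i = b i + c i) (hz : ∀ i, z i = c i + a (i + 1))
    (hfx : x.support.Finite) (hfy : y.support.Finite) :
    ∑ᶠ i : ℤ, (-1 : ℝ) ^ i * (y i : ℝ) =
      ∑ᶠ i : ℤ, (-1 : ℝ) ^ i * (x i : ℝ) + ∑ᶠ i : ℤ, (-1 : ℝ) ^ i * (z i : ℝ) := by
  have hfin {u v : ℤ → ℝ≥0} (hv : v.support.Finite) (huv : ∀ i, v i = 0 → u i = 0) :
      (Function.support fun i : ℤ => (-1 : ℝ) ^ i * (u i : ℝ)).Finite :=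
    hv.subset fun i hi hvi => hi (by simp [huv i hvi])
  have ha := hfin (u := a) hfx fun i hi => (add_eq_zero.1 ((hx i).symm.trans hi)).1
  have hb := hfin (u := b) hfx fun i hi => (add_eq_zero.1 ((hx i).symm.trans hi)).2
  have hc := hfin (u := c) hfy fun i hi => (add_eq_zero.1 ((hy i).symm.trans hi)).2
  have hshift : ∀ i : ℤ, (-1 : ℝ) ^ i * (a (i + 1) : ℝ) =
      -((-1 : ℝ) ^ (i + 1) * (a (i + 1) : ℝ)) := fun i => by
    rw [zpow_add_one₀ (by norm_num)]; ring
  have ha' : (Function.support fun i : ℤ => (-1 : ℝ) ^ (i + 1) * (a (i + 1) : ℝ)).Finite :=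
    ha.preimage (add_left_injective (1 : ℤ)).injOn
  have hsum : ∑ᶠ i : ℤ, (-1 : ℝ) ^ (i + 1) * (a (i + 1) : ℝ) = ∑ᶠ i : ℤ, (-1 : ℝ) ^ i * (a i : ℝ) :=
    finsum_comp_equiv (Equiv.addRight (1 : ℤ)) (f := fun i : ℤ => (-1 : ℝ) ^ i * (a i : ℝ))
  simp only [hx, hy, hz, NNReal.coe_add, mul_add, hshift, ← sub_eq_add_neg]
  rw [finsum_add_distrib hb hc, finsum_add_distrib ha hb, finsum_sub_distrib hc ha', hsum]
  ring

/-- The alternating sum of the weights of the `F^i(X)` is additive on distinguished triangles. -/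
lemma finsum_weight_eq_add_of_distTriang (F : C ⥤ A) [F.IsHomological]
    {O : Set A} {w : A → ℝ≥0}
    (hker : ClosedUnderKerCoker O) (hadd : IsAdditiveWeight O w)
    (T : Triangle C) (hT : T ∈ distTriang C)
    (h₁ : T.obj₁ ∈ LClass F O) (h₂ : T.obj₂ ∈ LClass F O) (h₃ : T.obj₃ ∈ LClass F O) :
    ∑ᶠ i : ℤ, (-1 : ℝ) ^ i * (w (F.obj (T.obj₂⟦i⟧)) : ℝ) =
      ∑ᶠ i : ℤ, (-1 : ℝ) ^ i * (w (F.obj (T.obj₁⟦i⟧)) : ℝ) +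
        ∑ᶠ i : ℤ, (-1 : ℝ) ^ i * (w (F.obj (T.obj₃⟦i⟧)) : ℝ) := by
  let : F.ShiftSequence ℤ := Functor.ShiftSequence.tautological F ℤ
  have hfin {X : C} (hX : X ∈ LClass F O) :
      (Function.support fun i : ℤ => w (F.obj (X⟦i⟧))).Finite :=
    hX.2.subset fun i hi hzero => hi (hadd.eq_zero_of_isZero (hX.1 i) hzero)
  exact finsum_negOnePow_mul_eq_add
    (fun i => hadd.eq_add_of_exact hker (F.homologySequence_exact₂ T hT i)
      (h₁.1 i) (h₂.1 i) (h₃.1 i))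
    (fun i => hadd.eq_add_of_exact hker (F.homologySequence_exact₃ T hT i _ rfl)
      (h₂.1 i) (h₃.1 i) (h₁.1 (i + 1)))
    (fun i => hadd.eq_add_of_exact hker (F.homologySequence_exact₁ T hT i _ rfl)
      (h₃.1 i) (h₁.1 (i + 1)) (h₂.1 (i + 1)))
    (hfin h₁) (hfin h₂)

/-- Proposition: if `w` is an additive weight on a class `𝒪` closed under kernels and
cokernels and `F` is a homological functor, then the induced weight `w̲_F` is exact on
`ℒ_{𝒯, F, 𝒪, w}`. -/
theorem inducedWeight_isExact (F : C ⥤ A) [F.IsHomological]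
    (O : Set A) (w : A → ℝ≥0)
    (hker : ClosedUnderKerCoker O) (hadd : IsAdditiveWeight O w)
    (T : Triangle C) (hT : T ∈ distTriang C)
    (h₁ : T.obj₁ ∈ LClass F O) (h₂ : T.obj₂ ∈ LClass F O) (h₃ : T.obj₃ ∈ LClass F O) :
    inducedWeight F w T.obj₁ ≤ inducedWeight F w T.obj₂ + inducedWeight F w T.obj₃ ∧
    inducedWeight F w T.obj₂ ≤ inducedWeight F w T.obj₁ + inducedWeight F w T.obj₃ ∧
    inducedWeight F w T.obj₃ ≤ inducedWeight F w T.obj₁ + inducedWeight F w T.obj₂ := by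
  unfold inducedWeight
  rw [finsum_weight_eq_add_of_distTriang F hker hadd T hT h₁ h₂ h₃]
  generalize ∑ᶠ i : ℤ, (-1 : ℝ) ^ i * (w (F.obj (T.obj₁⟦i⟧)) : ℝ) = x
  generalize ∑ᶠ i : ℤ, (-1 : ℝ) ^ i * (w (F.obj (T.obj₃⟦i⟧)) : ℝ) = z
  refine ⟨?_, abs_add_le x z, ?_⟩
  · simpa using abs_sub (x + z) z
  · simpa [add_comm] using abs_sub (x + z) x

end ExactWeightsTriangulated
end

section
/- Let 𝒯 be a pretriangulated category with suspension Σ, let 𝒮 be a class of objects of 𝒯 closed under Σ and Σ^{-1} and with the two-out-of-three property for distinguished triangles (if two of X, Y, Z in a distinguished triangle X → Y → Z → ΣX lie in 𝒮, so does the third), and let w be a weight on 𝒮. Then the following are equivalent: (i) w is exact; (ii) w is stable and w(ΣX) = w(X) for all X in 𝒮; (iii) w lower bounds its path metric and w(ΣX) ≤ w(X) for all X in 𝒮. -/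
open CategoryTheory CategoryTheory.Limits CategoryTheory.Pretriangulated ZeroObject
open scoped ENNReal

universe v u

namespace ExactWeightsTriangulated

variable {C : Type u} [Category.{v} C] [HasZeroObject C] [Preadditive C] [HasShift C ℤ]
  [∀ n : ℤ, (CategoryTheory.shiftFunctor C n).Additive] [Pretriangulated C]

/-- The weight `w` is *stable* if the restriction of `|d_w| = d_w(-, 0)` to `S` equals `w`. -/
def IsStable (S : Set C) (w : C → ℝ≥0∞) : Prop :=
  ∀ X ∈ S, pathDist S w X 0 = w X

/-- The weight `w` *lower bounds its path metric* if `|w X - w Y| ≤ d_w(X, Y)` for all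
`X, Y ∈ S`. -/
def LowerBoundsPathMetric (S : Set C) (w : C → ℝ≥0∞) : Prop :=
  ∀ X ∈ S, ∀ Y ∈ S, (w X - w Y) ⊔ (w Y - w X) ≤ pathDist S w X Y

section

variable {S : Set C} {w : C → ℝ≥0∞}

lemma pathDist_le_of_distTriang_left {T : Triangle C} (hT : T ∈ distTriang C) (h₃ : T.obj₃ ∈ S)
    (W : C) : pathDist S w T.obj₁ W ≤ w T.obj₃ + pathDist S w T.obj₂ W := by
  unfold pathDist
  rw [ENNReal.add_iInf]
  exact le_iInf fun γ ↦ iInf_le _ (ConeZigzag.fwd T.mor₁ T.obj₃ T.mor₂ T.mor₃ h₃ hT γ)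

lemma pathDist_le_of_distTriang_right {T : Triangle C} (hT : T ∈ distTriang C) (h₃ : T.obj₃ ∈ S)
    (W : C) : pathDist S w T.obj₂ W ≤ w T.obj₃ + pathDist S w T.obj₁ W := by
  unfold pathDist
  rw [ENNReal.add_iInf]
  exact le_iInf fun γ ↦ iInf_le _ (ConeZigzag.bwd T.mor₁ T.obj₃ T.mor₂ T.mor₃ h₃ hT γ)

lemma pathDist_self (X : C) : pathDist S w X X = 0 :=
  le_antisymm (iInf_le _ (ConeZigzag.nil X)) zero_le

lemma pathDist_zero_le {X : C} (hX : X ∈ S) : pathDist S w X 0 ≤ w X := by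
  simpa [pathDist_self] using
    pathDist_le_of_distTriang_right (w := w) (contractible_distinguished₁ X) hX 0

/-- The third inequality of exactness follows from the second one by rotating the triangle. -/
lemma isExactWeight_of_le_add
    (hS : ∀ X ∈ S, (X⟦(1 : ℤ)⟧ : C) ∈ S)
    (hw : ∀ X ∈ S, w ((X⟦(1 : ℤ)⟧ : C)) ≤ w X)
    (h : ∀ T ∈ distTriang C, T.obj₁ ∈ S → T.obj₂ ∈ S → T.obj₃ ∈ S →
      w T.obj₁ ≤ w T.obj₂ + w T.obj₃ ∧ w T.obj₂ ≤ w T.obj₁ + w T.obj₃) :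
    IsExactWeight S w := by
  intro T hT h₁ h₂ h₃
  refine ⟨(h T hT h₁ h₂ h₃).1, (h T hT h₁ h₂ h₃).2, ?_⟩
  have h_rot : w T.obj₃ ≤ w T.obj₂ + w (T.obj₁⟦(1 : ℤ)⟧) :=
    (h T.rotate (rot_of_distTriang T hT) h₂ h₃ (hS _ h₁)).2
  rw [add_comm (w T.obj₁)]
  exact h_rot.trans (by gcongr; exact hw _ h₁)

lemma IsStable.isExactWeight (h : IsStable S w)
    (hS : ∀ X ∈ S, (X⟦(1 : ℤ)⟧ : C) ∈ S)
    (hw : ∀ X ∈ S, w ((X⟦(1 : ℤ)⟧ : C)) ≤ w X) : IsExactWeight S w := by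
  refine isExactWeight_of_le_add hS hw fun T hT h₁ h₂ h₃ ↦ ?_
  rw [add_comm (w T.obj₂), add_comm (w T.obj₁), ← h _ h₁, ← h _ h₂]
  exact ⟨pathDist_le_of_distTriang_left hT h₃ 0, pathDist_le_of_distTriang_right hT h₃ 0⟩

lemma LowerBoundsPathMetric.isExactWeight (h : LowerBoundsPathMetric S w)
    (hS : ∀ X ∈ S, (X⟦(1 : ℤ)⟧ : C) ∈ S)
    (hw : ∀ X ∈ S, w ((X⟦(1 : ℤ)⟧ : C)) ≤ w X) : IsExactWeight S w := by
  refine isExactWeight_of_le_add hS hw fun T hT h₁ h₂ h₃ ↦ ?_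
  have h_dist : pathDist S w T.obj₁ T.obj₂ ≤ w T.obj₃ := by
    simpa [pathDist_self] using pathDist_le_of_distTriang_left (w := w) hT h₃ T.obj₂
  have h_sub := (h _ h₁ _ h₂).trans h_dist
  rw [sup_le_iff, tsub_le_iff_left, tsub_le_iff_left] at h_sub
  exact h_sub

lemma IsExactWeight.map_shift (h : IsExactWeight S w) (hS0 : (0 : C) ∈ S) (hw0 : w 0 = 0)
    (hS : ∀ X ∈ S, (X⟦(1 : ℤ)⟧ : C) ∈ S) {X : C} (hX : X ∈ S) :
    w ((X⟦(1 : ℤ)⟧ : C)) = w X := by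
  obtain ⟨h₁, -, h₃⟩ := h _ (contractible_distinguished₂ X) hX hS0 (hS X hX)
  simp only [Triangle.mk_obj₁, Triangle.mk_obj₂, Triangle.mk_obj₃, hw0, zero_add, add_zero]
    at h₁ h₃
  exact le_antisymm h₃ h₁

lemma IsExactWeight.le_add_cost (h : IsExactWeight S w)
    (h23 : ∀ T ∈ distTriang C,
      (T.obj₁ ∈ S → T.obj₃ ∈ S → T.obj₂ ∈ S) ∧ (T.obj₂ ∈ S → T.obj₃ ∈ S → T.obj₁ ∈ S))
    {X Y : C} (γ : ConeZigzag S X Y) (hX : X ∈ S) :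
    w X ≤ w Y + cost w γ ∧ w Y ≤ w X + cost w γ := by
  induction γ with
  | nil X => simp [cost]
  | @fwd X Y W f Z g k hZ hT γ ih =>
    have hY : Y ∈ S := (h23 _ hT).1 hX hZ
    obtain ⟨h₁, h₂, -⟩ := h _ hT hX hY hZ
    obtain ⟨ih₁, ih₂⟩ := ih hY
    simp only [Triangle.mk_obj₁, Triangle.mk_obj₂, Triangle.mk_obj₃] at h₁ h₂
    simp only [cost]
    constructor
    · calc w X ≤ w Y + w Z := h₁
        _ ≤ (w W + cost w γ) + w Z := by gcongr
        _ = w W + (w Z + cost w γ) := by ring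
    · calc w W ≤ w Y + cost w γ := ih₂
        _ ≤ (w X + w Z) + cost w γ := by gcongr
        _ = w X + (w Z + cost w γ) := by ring
  | @bwd X Y W f Z g k hZ hT γ ih =>
    have hY : Y ∈ S := (h23 _ hT).2 hX hZ
    obtain ⟨h₁, h₂, -⟩ := h _ hT hY hX hZ
    obtain ⟨ih₁, ih₂⟩ := ih hY
    simp only [Triangle.mk_obj₁, Triangle.mk_obj₂, Triangle.mk_obj₃] at h₁ h₂
    simp only [cost]
    constructor
    · calc w X ≤ w Y + w Z := h₂
        _ ≤ (w W + cost w γ) + w Z := by gcongr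
        _ = w W + (w Z + cost w γ) := by ring
    · calc w W ≤ w Y + cost w γ := ih₂
        _ ≤ (w X + w Z) + cost w γ := by gcongr
        _ = w X + (w Z + cost w γ) := by ring

lemma IsExactWeight.lowerBoundsPathMetric (h : IsExactWeight S w)
    (h23 : ∀ T ∈ distTriang C,
      (T.obj₁ ∈ S → T.obj₃ ∈ S → T.obj₂ ∈ S) ∧ (T.obj₂ ∈ S → T.obj₃ ∈ S → T.obj₁ ∈ S)) :
    LowerBoundsPathMetric S w := by
  intro X hX Y _
  refine le_iInf fun γ ↦ ?_
  rw [sup_le_iff, tsub_le_iff_left, tsub_le_iff_left]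
  exact h.le_add_cost h23 γ hX

lemma LowerBoundsPathMetric.isStable (h : LowerBoundsPathMetric S w) (hS0 : (0 : C) ∈ S)
    (hw0 : w 0 = 0) : IsStable S w := by
  intro X hX
  refine le_antisymm (pathDist_zero_le hX) ?_
  simpa [hw0] using h X hX 0 hS0

end

/-- Theorem 1.5: three equivalent characterizations of exactness for a weight on a
pretriangulated category, when `S` is closed under suspension (and its inverse) and
satisfies the two-out-of-three property for distinguished triangles. -/
theorem isExactWeight_tfae (S : Set C) (w : C → ℝ≥0∞)
    (hS0 : (0 : C) ∈ S) (hSiso : ∀ {X Y : C}, (X ≅ Y) → X ∈ S → Y ∈ S)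
    (hw0 : w 0 = 0) (hwiso : ∀ {X Y : C}, (X ≅ Y) → w X = w Y)
    (hSshift : ∀ X ∈ S, ∀ i : ℤ, (X⟦i⟧ : C) ∈ S)
    (h23 : ∀ T ∈ distTriang C,
      (T.obj₁ ∈ S → T.obj₂ ∈ S → T.obj₃ ∈ S) ∧
      (T.obj₁ ∈ S → T.obj₃ ∈ S → T.obj₂ ∈ S) ∧
      (T.obj₂ ∈ S → T.obj₃ ∈ S → T.obj₁ ∈ S)) :
    (IsExactWeight S w ↔
      (IsStable S w ∧ ∀ X ∈ S, w ((X⟦(1 : ℤ)⟧ : C)) = w X)) ∧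
    ((IsStable S w ∧ ∀ X ∈ S, w ((X⟦(1 : ℤ)⟧ : C)) = w X) ↔
      (LowerBoundsPathMetric S w ∧ ∀ X ∈ S, w ((X⟦(1 : ℤ)⟧ : C)) ≤ w X)) := by
  have hS : ∀ X ∈ S, (X⟦(1 : ℤ)⟧ : C) ∈ S := fun X hX ↦ hSshift X hX 1
  have h_lower (h : IsExactWeight S w) : LowerBoundsPathMetric S w :=
    h.lowerBoundsPathMetric fun T hT ↦ (h23 T hT).2
  have h_shift (h : IsExactWeight S w) : ∀ X ∈ S, w ((X⟦(1 : ℤ)⟧ : C)) = w X :=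
    fun _ hX ↦ h.map_shift hS0 hw0 hS hX
  have h_stable : IsExactWeight S w ↔
      (IsStable S w ∧ ∀ X ∈ S, w ((X⟦(1 : ℤ)⟧ : C)) = w X) :=
    ⟨fun h ↦ ⟨(h_lower h).isStable hS0 hw0, h_shift h⟩,
      fun ⟨h, hw⟩ ↦ h.isExactWeight hS fun X hX ↦ (hw X hX).le⟩
  refine ⟨h_stable, h_stable.symm.trans ?_⟩
  exact ⟨fun h ↦ ⟨h_lower h, fun X hX ↦ (h_shift h X hX).le⟩,
    fun ⟨h, hw⟩ ↦ h.isExactWeight hS hw⟩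

end ExactWeightsTriangulated
end

section
/- With 𝒫, P, μ, 𝒜, 𝒪, w, 𝒯, ℱ as in the persistence setting, with w additive: for all objects M• and N• in 𝒯^𝒯_{𝒪,μ,w̲_ℱ}, ∫_P | w̲_ℱ(M•) − w̲_ℱ(N•) | dμ ≤ d_{μ∘w̲_ℱ}(M•, N•). -/
open CategoryTheory CategoryTheory.Limits CategoryTheory.Pretriangulated ZeroObject
open MeasureTheory
open scoped ENNReal NNReal

universe v u v₂ u₂

namespace ExactWeightsTriangulated

variable {C : Type u} [Category.{v} C] [HasZeroObject C] [Preadditive C] [HasShift C ℤ]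
  [∀ n : ℤ, (CategoryTheory.shiftFunctor C n).Additive] [Pretriangulated C]

variable {A : Type u₂} [Category.{v₂} A] [Abelian A]

section Persistence

/-- The triangulated category of persistence modules under consideration: the homotopy
category `K(𝒜^𝒫)` of complexes of persistence modules `𝒫 ⥤ 𝒜`. (The derived category
`D(𝒜^𝒫)` is treated in the same way.) -/
abbrev PersCat (P : Type) [SmallCategory P] (A : Type u₂) [Category.{v₂} A] [Abelian A] :=
  HomotopyCategory (P ⥤ A) (ComplexShape.up ℤ)

variable {P : Type} [SmallCategory P] {A : Type u₂} [Category.{v₂} A] [Abelian A]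

/-- The weight `w̲_ℱ(M)(p) = w̲_{F_p}(M)` induced by a family `ℱ = {F_p}` of homological
functors. -/
noncomputable def familyWeight (F : ∀ _ : P, PersCat P A ⥤ A) (w : A → ℝ≥0)
    (M : PersCat P A) (p : P) : ℝ :=
  inducedWeight (F p) w M

variable [MeasurableSpace P]

/-- The class `𝒯^𝒯_{𝒪, μ, w̲_ℱ}` of objects lying in `ℒ_p` for all `p ∈ P` and whose
induced weight function `p ↦ w̲_ℱ(M)(p)` is `μ`-integrable. -/
def TTClass (F : ∀ _ : P, PersCat P A ⥤ A) (O : Set A) (w : A → ℝ≥0) (μ : Measure P) :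
    Set (PersCat P A) :=
  {M | (∀ p : P, M ∈ LClass (F p) O) ∧ Integrable (fun p : P => familyWeight F w M p) μ}

/-- The weight `μ ∘ w̲_ℱ : M ↦ ∫_P w̲_ℱ(M) dμ`. -/
noncomputable def muWeight (F : ∀ _ : P, PersCat P A ⥤ A) (w : A → ℝ≥0) (μ : Measure P)
    (M : PersCat P A) : ℝ :=
  ∫ p : P, familyWeight F w M p ∂μ

end Persistence

section ExactSequences

variable {A : Type u₂} [Category.{v₂} A] [Abelian A]

/-- An exact sequence `0 ⟶ U ⟶ V ⟶ W ⟶ T` gives a short exact sequence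
`0 ⟶ U ⟶ V ⟶ ker (W ⟶ T) ⟶ 0`. -/
lemma shortExact_kernelLift {U V W T : A} {a : U ⟶ V} {b : V ⟶ W} {c : W ⟶ T} [Mono a]
    (hab : a ≫ b = 0) (hbc : b ≫ c = 0) (h₁ : (ShortComplex.mk a b hab).Exact)
    (h₂ : (ShortComplex.mk b c hbc).Exact) :
    (ShortComplex.mk a (kernel.lift c b hbc)
      (by rw [← cancel_mono (kernel.ι c)]; simp [hab])).ShortExact := by
  have : Epi (kernel.lift c b hbc) := h₂.epi_kernelLift
  refine ShortComplex.ShortExact.mk' ?_ inferInstance inferInstance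
  let φ : ShortComplex.mk a (kernel.lift c b hbc)
      (by rw [← cancel_mono (kernel.ι c)]; simp [hab]) ⟶ ShortComplex.mk a b hab :=
    { τ₁ := 𝟙 _, τ₂ := 𝟙 _, τ₃ := kernel.ι c }
  have : Epi φ.τ₁ := inferInstanceAs (Epi (𝟙 U))
  have : IsIso φ.τ₂ := inferInstanceAs (IsIso (𝟙 V))
  have : Mono φ.τ₃ := inferInstanceAs (Mono (kernel.ι c))
  exact (ShortComplex.exact_iff_of_epi_of_isIso_of_mono φ).2 h₁

/-- An exact sequence `U ⟶ V ⟶ W ⟶ T ⟶ 0` gives a short exact sequence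
`0 ⟶ coker (U ⟶ V) ⟶ W ⟶ T ⟶ 0`. -/
lemma shortExact_cokernelDesc {U V W T : A} {a : U ⟶ V} {b : V ⟶ W} {c : W ⟶ T} [Epi c]
    (hab : a ≫ b = 0) (hbc : b ≫ c = 0) (h₁ : (ShortComplex.mk a b hab).Exact)
    (h₂ : (ShortComplex.mk b c hbc).Exact) :
    (ShortComplex.mk (cokernel.desc a b hab) c
      (by rw [← cancel_epi (cokernel.π a)]; simp [hbc])).ShortExact := by
  have : Mono (cokernel.desc a b hab) := h₁.mono_cokernelDesc
  refine ShortComplex.ShortExact.mk' ?_ inferInstance inferInstance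
  let φ : ShortComplex.mk b c hbc ⟶ ShortComplex.mk (cokernel.desc a b hab) c
      (by rw [← cancel_epi (cokernel.π a)]; simp [hbc]) :=
    { τ₁ := cokernel.π a, τ₂ := 𝟙 _, τ₃ := 𝟙 _ }
  have : Epi φ.τ₁ := inferInstanceAs (Epi (cokernel.π a))
  have : IsIso φ.τ₂ := inferInstanceAs (IsIso (𝟙 W))
  have : Mono φ.τ₃ := inferInstanceAs (Mono (𝟙 T))
  exact (ShortComplex.exact_iff_of_epi_of_isIso_of_mono φ).1 h₂

/-- An exact sequence `U ⟶ V ⟶ W ⟶ T ⟶ S` gives a short exact sequence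
`0 ⟶ coker (U ⟶ V) ⟶ W ⟶ ker (T ⟶ S) ⟶ 0`. -/
lemma exists_shortExact_cokernel_kernel {U V W T S : A} {a : U ⟶ V} {b : V ⟶ W} {c : W ⟶ T}
    {d : T ⟶ S} (hab : a ≫ b = 0) (hbc : b ≫ c = 0) (hcd : c ≫ d = 0)
    (h₁ : (ShortComplex.mk a b hab).Exact) (h₂ : (ShortComplex.mk b c hbc).Exact)
    (h₃ : (ShortComplex.mk c d hcd).Exact) :
    ∃ (i : cokernel a ⟶ W) (q : W ⟶ kernel d) (h : i ≫ q = 0),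
      (ShortComplex.mk i q h).ShortExact := by
  have hl : b ≫ kernel.lift d c hcd = 0 := by
    rw [← cancel_mono (kernel.ι d)]; simp [hbc]
  have : Epi (kernel.lift d c hcd) := h₃.epi_kernelLift
  let φ : ShortComplex.mk b (kernel.lift d c hcd) hl ⟶ ShortComplex.mk b c hbc :=
    { τ₁ := 𝟙 _, τ₂ := 𝟙 _, τ₃ := kernel.ι d }
  have : Epi φ.τ₁ := inferInstanceAs (Epi (𝟙 V))
  have : IsIso φ.τ₂ := inferInstanceAs (IsIso (𝟙 W))
  have : Mono φ.τ₃ := inferInstanceAs (Mono (kernel.ι d))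
  exact ⟨_, _, _, shortExact_cokernelDesc hab hl h₁
    ((ShortComplex.exact_iff_of_epi_of_isIso_of_mono φ).2 h₂)⟩

/-- For a monomorphism `i : X ⟶ Y` and `f : Y ⟶ Z`, there is an exact sequence
`0 ⟶ ker (i ≫ f) ⟶ ker f ⟶ coker i ⟶ coker (i ≫ f) ⟶ coker f ⟶ 0`. -/
lemma exists_cokernel_to_cokernel_comp {X Y Z : A} (i : X ⟶ Y) [Mono i] (f : Y ⟶ Z) :
    ∃ δ : cokernel i ⟶ cokernel (i ≫ f),
      (∃ (j : kernel (i ≫ f) ⟶ kernel f) (q : kernel f ⟶ kernel δ) (h : j ≫ q = 0),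
        (ShortComplex.mk j q h).ShortExact) ∧ Nonempty (cokernel δ ≅ cokernel f) := by
  let S := kernelCokernelCompSequence.snakeInput i f
  have : Mono S.L₀.g := S.L₀_exact.mono_g ((isZero_kernel_of_mono i).eq_of_src _ _)
  have : Epi S.L₂.g := inferInstanceAs (Epi (biprod.snd : Y ⊞ Z ⟶ Z))
  have : Epi S.L₃.g := S.epi_L₃_g
  exact ⟨S.L₃.f, ⟨S.L₀.g, _, _, shortExact_kernelLift S.L₀_g_δ S.δ_L₃_f
      S.L₁'_exact S.L₂'_exact⟩,
    ⟨(colimit.isColimit _).coconePointUniqueUpToIso S.L₃_exact.gIsCokernel⟩⟩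

/-- For an epimorphism `q : Y ⟶ Z` and `f : X ⟶ Y`, there is an exact sequence
`0 ⟶ ker f ⟶ ker (f ≫ q) ⟶ ker q ⟶ coker f ⟶ coker (f ≫ q) ⟶ 0`. -/
lemma exists_kernel_comp_to_kernel {X Y Z : A} (f : X ⟶ Y) (q : Y ⟶ Z) [Epi q] :
    ∃ δ : kernel (f ≫ q) ⟶ kernel q,
      (∃ (j : cokernel δ ⟶ cokernel f) (r : cokernel f ⟶ cokernel (f ≫ q)) (h : j ≫ r = 0),
        (ShortComplex.mk j r h).ShortExact) ∧ Nonempty (kernel δ ≅ kernel f) := by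
  let S := kernelCokernelCompSequence.snakeInput f q
  have : Epi S.L₃.f := S.L₃_exact.epi_f ((isZero_cokernel_of_epi q).eq_of_tgt _ _)
  have : Mono S.L₁.f := inferInstanceAs (Mono (biprod.inl : X ⟶ X ⊞ Y))
  have : Mono S.L₀.f := S.mono_L₀_f
  exact ⟨S.L₀.g, ⟨_, S.L₃.f, _, shortExact_cokernelDesc S.L₀_g_δ S.δ_L₃_f
      S.L₁'_exact S.L₂'_exact⟩,
    ⟨(limit.isLimit _).conePointUniqueUpToIso S.L₀_exact.fIsKernel⟩⟩

end ExactSequences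

section HasWeight

variable {A : Type u₂} [Category.{v₂} A] [Abelian A]

/-- `HasWeight O w X a` means that `X` is an iterated extension of objects isomorphic to objects
of `O` whose weights add up to `a`. -/
inductive HasWeight (O : Set A) (w : A → ℝ≥0) : A → ℝ → Prop
  | of_iso {X Y : A} (hX : X ∈ O) (e : X ≅ Y) : HasWeight O w Y (w X)
  | ext {X Y : A} (i : X ⟶ Y) (hi : Mono i) {a b : ℝ} (hX : HasWeight O w X a)
      (hY : HasWeight O w (cokernel i) b) : HasWeight O w Y (a + b)

namespace HasWeight

variable {O : Set A} {w : A → ℝ≥0}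

lemma iso {X Y : A} {a : ℝ} (h : HasWeight O w X a) (e : X ≅ Y) : HasWeight O w Y a := by
  induction h generalizing Y with
  | of_iso hX e' => exact .of_iso hX (e' ≪≫ e)
  | ext i hi hX _ _ ihY =>
    exact .ext (i ≫ e.hom) inferInstance hX (ihY (cokernelCompIsIso i e.hom).symm)

lemma of_shortExact {S : ShortComplex A} (hS : S.ShortExact) {a b : ℝ}
    (h₁ : HasWeight O w S.X₁ a) (h₃ : HasWeight O w S.X₃ b) : HasWeight O w S.X₂ (a + b) := by
  have := hS.mono_f
  have := hS.epi_g
  exact .ext S.f hS.mono_f h₁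
    (h₃.iso (hS.exact.gIsCokernel.coconePointUniqueUpToIso (colimit.isColimit _)))

lemma weight_eq_zero_of_isZero (hadd : IsAdditiveWeight O w)
    {X : A} (hX : X ∈ O) (hz : IsZero X) : w X = 0 := by
  have hS : (ShortComplex.mk (0 : X ⟶ X) (0 : X ⟶ X) (by simp)).ShortExact := by
    refine ShortComplex.ShortExact.mk' (ShortComplex.exact_of_isZero_X₂ _ hz) ?_ ?_
    · exact ⟨fun _ _ _ => hz.eq_of_tgt _ _⟩
    · exact ⟨fun _ _ _ => hz.eq_of_src _ _⟩
  simpa using hadd _ hS hX hX hX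

lemma eq_zero_of_isZero (hadd : IsAdditiveWeight O w)
    {X : A} {a : ℝ} (h : HasWeight O w X a) (hz : IsZero X) : a = 0 := by
  induction h with
  | of_iso hX e => simp [weight_eq_zero_of_isZero hadd hX (hz.of_iso e)]
  | ext i hi _ _ ihX ihY =>
    rw [ihX (hz.of_mono i), ihY (hz.of_epi (cokernel.π i)), add_zero]

/-- The rank-nullity relation for a morphism between objects of `O`. -/
lemma weight_add_weight_cokernel (hker : ClosedUnderKerCoker O) (hadd : IsAdditiveWeight O w)
    {X Y : A} (hX : X ∈ O) (hY : Y ∈ O) (f : X ⟶ Y) :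
    w X + w (cokernel f) = w Y + w (kernel f) := by
  have hk := (hker f hX hY).1
  have hc := (hker f hX hY).2
  have hi := (hker (kernel.ι f) hk hX).2
  have h₁ : (ShortComplex.mk _ _ (cokernel.condition (kernel.ι f))).ShortExact :=
    ShortComplex.ShortExact.mk' (ShortComplex.exact_cokernel _) inferInstance inferInstance
  have h₂ := shortExact_cokernelDesc (kernel.condition f) (cokernel.condition f)
    (ShortComplex.exact_kernel f) (ShortComplex.exact_cokernel f)
  have e₁ := hadd _ h₁ hk hX hi
  have e₂ := hadd _ h₂ hi hY hc
  dsimp at e₁ e₂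
  rw [e₁, e₂]
  ring

/-- The kernel of a morphism from an object of `O` to an iterated extension of objects of `O`
is isomorphic to an object of `O`, and its cokernel is such an iterated extension. -/
lemma kernel_cokernel_of_mem (hker : ClosedUnderKerCoker O) (hadd : IsAdditiveWeight O w)
    {X Y : A} {b : ℝ} (hX : X ∈ O) (hY : HasWeight O w Y b)
    (f : X ⟶ Y) :
    ∃ (K : A) (c : ℝ), K ∈ O ∧ Nonempty (K ≅ kernel f) ∧ HasWeight O w (cokernel f) c ∧
      w X + c = b + w K := by
  induction hY generalizing X with
  | @of_iso Y₀ Y hY e =>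
    refine ⟨kernel (f ≫ e.inv), w (cokernel (f ≫ e.inv)), (hker _ hX hY).1,
      ⟨kernelCompMono f e.inv⟩, .of_iso (hker _ hX hY).2 (cokernelCompIsIso f e.inv), ?_⟩
    exact_mod_cast weight_add_weight_cokernel hker hadd hX hY (f ≫ e.inv)
  | @ext Y₁ Y i hi b₁ b₂ _ _ ih₁ ih₂ =>
    obtain ⟨K, c, hK, ⟨e⟩, hc, hw⟩ := ih₂ hX (f ≫ cokernel.π i)
    obtain ⟨δ, ⟨j, r, hjr, hS⟩, ⟨e₁⟩⟩ := exists_kernel_comp_to_kernel f (cokernel.π i)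
    let t : kernel (cokernel.π i) ≅ Y₁ :=
      (kernelIsKernel (cokernel.π i)).conePointUniqueUpToIso
        (ShortComplex.exact_cokernel i).fIsKernel
    obtain ⟨K', c', hK', ⟨e'⟩, hc', hw'⟩ := ih₁ hK (e.hom ≫ δ ≫ t.hom)
    refine ⟨K', c' + c, hK', ⟨e' ≪≫ kernelIsIsoComp _ _ ≪≫ kernelCompMono _ _ ≪≫ e₁⟩,
      of_shortExact hS (hc'.iso (cokernelEpiComp _ _ ≪≫ cokernelCompIsIso _ _)) hc, ?_⟩
    linarith

/-- Iterated extensions of objects of `O` are closed under kernels and cokernels, and the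
rank-nullity relation holds for them. -/
lemma kernel_cokernel (hker : ClosedUnderKerCoker O) (hadd : IsAdditiveWeight O w)
    {X Y : A} {a b : ℝ} (hX : HasWeight O w X a) (hY : HasWeight O w Y b)
    (f : X ⟶ Y) :
    ∃ k c : ℝ, HasWeight O w (kernel f) k ∧ HasWeight O w (cokernel f) c ∧ a + c = b + k := by
  induction hX generalizing Y b with
  | of_iso hX e =>
    obtain ⟨K, c, hK, ⟨e'⟩, hc, hw⟩ := kernel_cokernel_of_mem hker hadd hX hY (e.hom ≫ f)
    exact ⟨w K, c, .of_iso hK (e' ≪≫ kernelIsIsoComp _ _), hc.iso (cokernelEpiComp _ _), hw⟩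
  | ext i hi _ _ ih₁ ih₂ =>
    obtain ⟨k₁, c₁, hk₁, hc₁, hw₁⟩ := ih₁ hY (i ≫ f)
    obtain ⟨δ, ⟨j, q, hjq, hS⟩, ⟨e⟩⟩ := exists_cokernel_to_cokernel_comp i f
    obtain ⟨k₂, c₂, hk₂, hc₂, hw₂⟩ := ih₂ hc₁ δ
    exact ⟨k₁ + k₂, c₂, of_shortExact hS hk₁ hk₂, hc₂.iso e, by linarith⟩

lemma unique (hker : ClosedUnderKerCoker O) (hadd : IsAdditiveWeight O w)
    {X : A} {a b : ℝ} (ha : HasWeight O w X a) (hb : HasWeight O w X b) : a = b := by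
  obtain ⟨k, c, hk, hc, h⟩ := kernel_cokernel hker hadd ha hb (𝟙 X)
  have hk' := hk.eq_zero_of_isZero hadd (isZero_kernel_of_mono (𝟙 X))
  have hc' := hc.eq_zero_of_isZero hadd (isZero_cokernel_of_epi (𝟙 X))
  linarith

end HasWeight

end HasWeight

lemma finsum_neg_one_zpow_mul_add_one (e : ℤ → ℝ) :
    ∑ᶠ i : ℤ, (-1 : ℝ) ^ i * e (i + 1) = -∑ᶠ i : ℤ, (-1 : ℝ) ^ i * e i := by
  rw [← finsum_neg_distrib,
    ← finsum_comp_equiv (Equiv.addRight (1 : ℤ)) (f := fun i => -((-1 : ℝ) ^ i * e i))]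
  refine finsum_congr fun i => ?_
  simp [zpow_add₀]

section HasEuler

variable {A : Type u₂} [Category.{v₂} A] [Abelian A] {O : Set A} {w : A → ℝ≥0}

/-- `HasEuler O w X c` means that the finitely supported family `X` consists of iterated
extensions of objects of `O`, and that the alternating sum of their weights is `c`. -/
def HasEuler (O : Set A) (w : A → ℝ≥0) (X : ℤ → A) (c : ℝ) : Prop :=
  {i : ℤ | ¬ IsZero (X i)}.Finite ∧
    ∃ e : ℤ → ℝ, (∀ i, HasWeight O w (X i) (e i)) ∧ c = ∑ᶠ i : ℤ, (-1 : ℝ) ^ i * e i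

namespace HasEuler

variable {X Y Z : ℤ → A} {a b : ℝ}

lemma comp_add_one (h : HasEuler O w X a) : HasEuler O w (fun i => X (i + 1)) (-a) := by
  obtain ⟨hf, e, he, rfl⟩ := h
  exact ⟨hf.preimage (add_left_injective (1 : ℤ)).injOn, fun i => e (i + 1), fun i => he _,
    (finsum_neg_one_zpow_mul_add_one e).symm⟩

lemma of_comp_add_one (h : HasEuler O w (fun i => X (i + 1)) a) : HasEuler O w X (-a) := by
  obtain ⟨hf, e, he, rfl⟩ := h
  refine ⟨(hf.image (· + 1)).subset fun i hi => ⟨i - 1, by simpa using hi, by simp⟩,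
    fun i => e (i - 1), fun i => by simpa using he (i - 1), ?_⟩
  have := finsum_neg_one_zpow_mul_add_one (fun i => e (i - 1))
  simp only [add_sub_cancel_right] at this
  rw [this, neg_neg]

lemma unique (hker : ClosedUnderKerCoker O) (hadd : IsAdditiveWeight O w)
    (ha : HasEuler O w X a) (hb : HasEuler O w X b) : a = b := by
  obtain ⟨-, e, he, rfl⟩ := ha
  obtain ⟨-, e', he', rfl⟩ := hb
  simp only [fun i => (he i).unique hker hadd (he' i)]

/-- In a long exact sequence `⋯ ⟶ X i ⟶ Y i ⟶ Z i ⟶ X (i + 1) ⟶ ⋯`, the Euler characteristic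
of `Z` is determined by those of `X` and `Y`. -/
lemma of_exact (hker : ClosedUnderKerCoker O) (hadd : IsAdditiveWeight O w)
    (hX : HasEuler O w X a) (hY : HasEuler O w Y b)
    (f : ∀ i, X i ⟶ Y i) (g : ∀ i, Y i ⟶ Z i) (d : ∀ i, Z i ⟶ X (i + 1))
    (hfg : ∀ i, f i ≫ g i = 0) (hgd : ∀ i, g i ≫ d i = 0) (hdf : ∀ i, d i ≫ f (i + 1) = 0)
    (h₁ : ∀ i, (ShortComplex.mk _ _ (hfg i)).Exact)
    (h₂ : ∀ i, (ShortComplex.mk _ _ (hgd i)).Exact)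
    (h₃ : ∀ i, (ShortComplex.mk _ _ (hdf i)).Exact) :
    HasEuler O w Z (b - a) := by
  obtain ⟨hXf, x, hx, rfl⟩ := hX
  obtain ⟨hYf, y, hy, rfl⟩ := hY
  choose k c hk hc hw using fun i => HasWeight.kernel_cokernel hker hadd (hx i) (hy i) (f i)
  have hz : ∀ i, HasWeight O w (Z i) (c i + k (i + 1)) := fun i => by
    obtain ⟨j, q, h, hS⟩ := exists_shortExact_cokernel_kernel (hfg i) (hgd i) (hdf i)
      (h₁ i) (h₂ i) (h₃ i)
    exact HasWeight.of_shortExact hS (hc i) (hk (i + 1))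
  have hXf' := hXf.preimage (add_left_injective (1 : ℤ)).injOn
  refine ⟨(hYf.union hXf').subset fun i hi => ?_, _, hz, ?_⟩
  · by_contra hcon
    simp only [Set.mem_union, Set.mem_ofPred_eq, Set.mem_preimage, not_or, not_not] at hcon
    exact hi ((h₂ i).isZero_of_both_zeros (hcon.1.eq_of_src _ _) (hcon.2.eq_of_tgt _ _))
  have supp : ∀ {e : ℤ → ℝ} {s : Set ℤ}, s.Finite → (∀ i, i ∉ s → e i = 0) →
      (Function.support fun i : ℤ => (-1 : ℝ) ^ i * e i).Finite := fun hs he =>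
    hs.subset fun i hi => by
      by_contra h
      exact hi (by simp [he i h])
  have hxs := supp hXf fun i hi => (hx i).eq_zero_of_isZero hadd (not_not.1 hi)
  have hys := supp hYf fun i hi => (hy i).eq_zero_of_isZero hadd (not_not.1 hi)
  have hks := supp hXf fun i hi => (hk i).eq_zero_of_isZero hadd
    ((not_not.1 hi).of_mono (kernel.ι (f i)))
  have hks' := supp (e := fun i => k (i + 1)) hXf' fun i hi =>
    (hk (i + 1)).eq_zero_of_isZero hadd ((not_not.1 hi).of_mono (kernel.ι (f (i + 1))))
  have hsum : ∀ i : ℤ, (-1 : ℝ) ^ i * (c i + k (i + 1)) =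
      ((-1 : ℝ) ^ i * y i - (-1 : ℝ) ^ i * x i) +
        ((-1 : ℝ) ^ i * k i + (-1 : ℝ) ^ i * k (i + 1)) := fun i => by
    rw [show c i = y i + k i - x i by linarith [hw i]]
    ring
  rw [finsum_congr hsum, finsum_add_distrib, finsum_add_distrib hks hks',
    finsum_sub_distrib hys hxs, finsum_neg_one_zpow_mul_add_one]
  · ring
  · exact (hys.union hxs).subset (Function.support_sub _ _)
  · exact (hks.union hks').subset (Function.support_add _ _)

end HasEuler

end HasEuler

section Triangles

variable {C : Type u} [Category.{v} C] [HasShift C ℤ]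
  {A : Type u₂} [Category.{v₂} A] [Abelian A] {O : Set A} {w : A → ℝ≥0}

lemma hasEuler_of_mem_LClass {F : C ⥤ A} {X : C} (hX : X ∈ LClass F O) :
    HasEuler O w (fun i => F.obj (X⟦i⟧)) (∑ᶠ i : ℤ, (-1 : ℝ) ^ i * (w (F.obj (X⟦i⟧)) : ℝ)) :=
  ⟨hX.2, _, fun i => .of_iso (hX.1 i) (Iso.refl _), rfl⟩

variable [HasZeroObject C] [Preadditive C]
  [∀ n : ℤ, (CategoryTheory.shiftFunctor C n).Additive] [Pretriangulated C]
  (F : C ⥤ A) [F.IsHomological] {T : Triangle C} {a c : ℝ}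

/-- The Euler characteristic of the middle term of a distinguished triangle. -/
lemma HasEuler.obj₂ (hker : ClosedUnderKerCoker O) (hadd : IsAdditiveWeight O w)
    (hT : T ∈ distTriang C) (h₁ : HasEuler O w (fun i => F.obj (T.obj₁⟦i⟧)) a)
    (h₃ : HasEuler O w (fun i => F.obj (T.obj₃⟦i⟧)) c) :
    HasEuler O w (fun i => F.obj (T.obj₂⟦i⟧)) (a + c) := by
  let : F.ShiftSequence ℤ := Functor.ShiftSequence.tautological F ℤ
  have := HasEuler.of_exact (Z := fun i => F.obj (T.obj₂⟦i + 1⟧)) hker hadd h₃ h₁.comp_add_one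
    (fun i => F.homologySequenceδ T i (i + 1) rfl)
    (fun i => (F.shift (i + 1)).map T.mor₁) (fun i => (F.shift (i + 1)).map T.mor₂)
    (fun i => F.homologySequenceδ_comp T hT _ _ _) (fun i => F.homologySequence_comp T hT _)
    (fun i => F.comp_homologySequenceδ T hT _ _ _)
    (fun i => F.homologySequence_exact₁ T hT _ _ _) (fun i => F.homologySequence_exact₂ T hT _)
    (fun i => F.homologySequence_exact₃ T hT _ _ _)
  convert HasEuler.of_comp_add_one (X := fun i => F.obj (T.obj₂⟦i⟧)) this using 1
  ring

/-- The Euler characteristic of the first term of a distinguished triangle. -/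
lemma HasEuler.obj₁ (hker : ClosedUnderKerCoker O) (hadd : IsAdditiveWeight O w)
    (hT : T ∈ distTriang C) (h₂ : HasEuler O w (fun i => F.obj (T.obj₂⟦i⟧)) a)
    (h₃ : HasEuler O w (fun i => F.obj (T.obj₃⟦i⟧)) c) :
    HasEuler O w (fun i => F.obj (T.obj₁⟦i⟧)) (a - c) := by
  let : F.ShiftSequence ℤ := Functor.ShiftSequence.tautological F ℤ
  have := HasEuler.of_exact (Z := fun i => F.obj (T.obj₁⟦i + 1⟧)) hker hadd h₂ h₃
    (fun i => (F.shift i).map T.mor₂) (fun i => F.homologySequenceδ T i (i + 1) rfl)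
    (fun i => (F.shift (i + 1)).map T.mor₁)
    (fun i => F.comp_homologySequenceδ T hT _ _ _) (fun i => F.homologySequenceδ_comp T hT _ _ _)
    (fun i => F.homologySequence_comp T hT _)
    (fun i => F.homologySequence_exact₃ T hT _ _ _)
    (fun i => F.homologySequence_exact₁ T hT _ _ _) (fun i => F.homologySequence_exact₂ T hT _)
  convert HasEuler.of_comp_add_one (X := fun i => F.obj (T.obj₁⟦i⟧)) this using 1
  ring

end Triangles

section Zigzags

variable {P : Type} [SmallCategory P] {A : Type u₂} [Category.{v₂} A] [Abelian A]
  [MeasurableSpace P] {F : ∀ _ : P, PersCat P A ⥤ A} {O : Set A} {w : A → ℝ≥0} {μ : Measure P}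

/-- Along a zigzag, the Euler characteristics move pointwise by at most an integrable function
whose integral is bounded by the cost. -/
lemma exists_integrable_bound_of_zigzag (hF : ∀ p : P, (F p).IsHomological)
    (hker : ClosedUnderKerCoker O) (hadd : IsAdditiveWeight O w) {X W : PersCat P A}
    (γ : ConeZigzag (TTClass F O w μ) X W) :
    ∃ c : P → ℝ, Integrable c μ ∧
      ENNReal.ofReal (∫ p, c p ∂μ) ≤
        cost (fun X => ENNReal.ofReal (muWeight F w μ X)) γ ∧
      ∀ (p : P) (a : ℝ), HasEuler O w (fun i => (F p).obj (X⟦i⟧)) a →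
        ∃ b, HasEuler O w (fun i => (F p).obj (W⟦i⟧)) b ∧ |a - b| ≤ c p := by
  have add_bound : ∀ {Z : PersCat P A} {c : P → ℝ} {r : ℝ≥0∞}, Z ∈ TTClass F O w μ →
      Integrable c μ → ENNReal.ofReal (∫ p, c p ∂μ) ≤ r →
      ENNReal.ofReal (∫ p, (familyWeight F w Z p + c p) ∂μ) ≤
        ENNReal.ofReal (muWeight F w μ Z) + r := by
    intro Z c r hZ hc hr
    rw [integral_add hZ.2 hc]
    exact ENNReal.ofReal_add_le.trans (by gcongr; rfl)
  induction γ with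
  | nil X => exact ⟨0, integrable_zero _ _ _, by simp [cost], fun p a ha => ⟨a, ha, by simp⟩⟩
  | fwd f Z g h hZ hT rest ih =>
    obtain ⟨c, hc, hcost, hb⟩ := ih
    refine ⟨fun p => familyWeight F w Z p + c p, hZ.2.add hc,
      add_bound hZ hc hcost, fun p a ha => ?_⟩
    have := hF p
    obtain ⟨b, hWb, hab⟩ := hb p _ (HasEuler.obj₂ (F p) hker hadd hT ha
      (hasEuler_of_mem_LClass (hZ.1 p)))
    refine ⟨b, hWb, ?_⟩
    rw [abs_le] at hab ⊢
    have h₁ := neg_abs_le (∑ᶠ i : ℤ, (-1 : ℝ) ^ i * (w ((F p).obj (Z⟦i⟧)) : ℝ))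
    have h₂ := le_abs_self (∑ᶠ i : ℤ, (-1 : ℝ) ^ i * (w ((F p).obj (Z⟦i⟧)) : ℝ))
    simp only [familyWeight, inducedWeight, Triangle.mk_obj₃] at *
    constructor <;> linarith
  | bwd f Z g h hZ hT rest ih =>
    obtain ⟨c, hc, hcost, hb⟩ := ih
    refine ⟨fun p => familyWeight F w Z p + c p, hZ.2.add hc,
      add_bound hZ hc hcost, fun p a ha => ?_⟩
    have := hF p
    obtain ⟨b, hWb, hab⟩ := hb p _ (HasEuler.obj₁ (F p) hker hadd hT ha
      (hasEuler_of_mem_LClass (hZ.1 p)))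
    refine ⟨b, hWb, ?_⟩
    rw [abs_le] at hab ⊢
    have h₁ := neg_abs_le (∑ᶠ i : ℤ, (-1 : ℝ) ^ i * (w ((F p).obj (Z⟦i⟧)) : ℝ))
    have h₂ := le_abs_self (∑ᶠ i : ℤ, (-1 : ℝ) ^ i * (w ((F p).obj (Z⟦i⟧)) : ℝ))
    simp only [familyWeight, inducedWeight, Triangle.mk_obj₃] at *
    constructor <;> linarith

end Zigzags

/-- Proposition 3.7: lower bound for the path metric associated to `μ ∘ w̲_ℱ`. -/
theorem integral_abs_sub_le_pathDist_muWeight {P : Type} [SmallCategory P] [MeasurableSpace P]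
    {A : Type u₂} [Category.{v₂} A] [Abelian A]
    (F : ∀ _ : P, PersCat P A ⥤ A) (hF : ∀ p : P, (F p).IsHomological)
    (O : Set A) (w : A → ℝ≥0)
    (hker : ClosedUnderKerCoker O) (hadd : IsAdditiveWeight O w)
    (μ : Measure P) (M N : PersCat P A)
    (hM : M ∈ TTClass F O w μ) (hN : N ∈ TTClass F O w μ) :
    ENNReal.ofReal (∫ p : P, |familyWeight F w M p - familyWeight F w N p| ∂μ) ≤
      pathDist (TTClass F O w μ) (fun X => ENNReal.ofReal (muWeight F w μ X)) M N := by
  refine le_iInf fun γ => ?_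
  obtain ⟨c, hc, hcost, hb⟩ := exists_integrable_bound_of_zigzag hF hker hadd γ
  refine le_trans (ENNReal.ofReal_le_ofReal ?_) hcost
  refine integral_mono (hM.2.sub hN.2).abs hc fun p => ?_
  obtain ⟨b, hWb, hab⟩ := hb p _ (hasEuler_of_mem_LClass (hM.1 p))
  rw [hWb.unique hker hadd (hasEuler_of_mem_LClass (hN.1 p))] at hab
  exact (abs_abs_sub_abs_le_abs_sub _ _).trans hab

end ExactWeightsTriangulated
end
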